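/- Let 𝔅' ⊆ 𝔅(X) be nonempty and placible. Then dim 𝒟(X,𝔅') = |𝔅'|. -/

import Mathlib

noncomputable section

variable {r N : ℕ}

/-- `p_u`, the degree-one polynomial associated with the vector `u ∈ ℝ^r`. -/
def linPoly {r : ℕ} (u : Fin r → ℝ) : MvPolynomial (Fin r) ℝ :=
  ∑ i, MvPolynomial.C (u i) * MvPolynomial.X i

/-- `p_Y = ∏_{i ∈ Y} p_{X i}` for a sublist `Y` of the list `X`. -/
def prodPoly {r N : ℕ} (X : Fin N → Fin r → ℝ) (Y : Finset (Fin N)) : MvPolynomial (Fin r) ℝ :=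
  ∏ i ∈ Y, linPoly (X i)

/-- The pairing `⟨p, f⟩ = (p(∂/∂t₁,…,∂/∂t_r) f)(0)`, written via coefficients:
`⟨p,f⟩ = ∑_α α! · p_α · f_α`. -/
def pairing {r : ℕ} (p f : MvPolynomial (Fin r) ℝ) : ℝ :=
  ∑ α ∈ p.support, (∏ i, ((α i).factorial : ℝ)) * p.coeff α * f.coeff α

lemma pairing_zero {r : ℕ} (q : MvPolynomial (Fin r) ℝ) : pairing q 0 = 0 := by
  simp [pairing]

lemma pairing_add {r : ℕ} (q f g : MvPolynomial (Fin r) ℝ) :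
    pairing q (f + g) = pairing q f + pairing q g := by
  unfold pairing
  rw [← Finset.sum_add_distrib]
  exact Finset.sum_congr rfl fun α _ => by rw [MvPolynomial.coeff_add]; ring

lemma pairing_smul {r : ℕ} (q : MvPolynomial (Fin r) ℝ) (c : ℝ) (f : MvPolynomial (Fin r) ℝ) :
    pairing q (c • f) = c * pairing q f := by
  unfold pairing
  rw [Finset.mul_sum]
  exact Finset.sum_congr rfl fun α _ => by rw [MvPolynomial.coeff_smul, smul_eq_mul]; ring

/-- The kernel (Macaulay inverse system) of an ideal `I`:
all polynomials annihilated (in the sense of the pairing) by every element of `I`. -/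
def kerIdeal {r : ℕ} (I : Ideal (MvPolynomial (Fin r) ℝ)) :
    Submodule ℝ (MvPolynomial (Fin r) ℝ) where
  carrier := {f | ∀ q ∈ I, pairing q f = 0}
  add_mem' := fun hf hg q hq => by
    rw [pairing_add, hf q hq, hg q hq, add_zero]
  zero_mem' := fun q _ => pairing_zero q
  smul_mem' := fun c f hf q hq => by
    rw [pairing_smul, hf q hq, mul_zero]

section Lists

variable {M : Type*} [AddCommGroup M] [Module ℝ M]

/-- `B ⊆ G` is (the index set of) a sublist of the list `v` restricted to the ground set `G`
that is a basis of the ambient space. -/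
def basesOn (v : Fin N → M) (G : Finset (Fin N)) : Set (Finset (Fin N)) :=
  {B | B ⊆ G ∧ LinearIndependent ℝ ((B : Set (Fin N)).restrict v) ∧
    Submodule.span ℝ (v '' (B : Set (Fin N))) = ⊤}

/-- `j` is externally active with respect to the basis `B`:
`v j ∈ span {v e : e ∈ B, e ≤ j}` and `j ∉ B`. -/
def isExtActive (v : Fin N → M) (B : Finset (Fin N)) (j : Fin N) : Prop :=
  j ∉ B ∧ v j ∈ Submodule.span ℝ (v '' {e : Fin N | e ∈ B ∧ e ≤ j})

open Classical in
/-- The set `E(B)` of externally active elements (within the ground set `G`). -/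
def extSetOn (v : Fin N → M) (G B : Finset (Fin N)) : Finset (Fin N) :=
  G.filter (fun j => isExtActive v B j)

/-- `C` is a cocircuit w.r.t. the collection of bases `𝔅`: an inclusion-minimal
sublist of the ground set `G` intersecting every basis in `𝔅`. -/
def isCocircuitOn (G : Finset (Fin N)) (𝔅 : Set (Finset (Fin N))) (C : Finset (Fin N)) : Prop :=
  C ⊆ G ∧ (∀ B ∈ 𝔅, (C ∩ B).Nonempty) ∧
    ∀ C' ⊆ C, (∀ B ∈ 𝔅, (C' ∩ B).Nonempty) → C' = C

/-- A set of bases `𝔅` of the list `v` has the forward exchange property. -/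
def forwardExchange (v : Fin N → M) (𝔅 : Set (Finset (Fin N))) : Prop :=
  ∀ B ∈ 𝔅, ∀ b ∈ B, ∀ j : Fin N,
    v j ∈ Submodule.span ℝ (v '' {e : Fin N | e ∈ B ∧ e ≤ b}) →
    v j ∉ Submodule.span ℝ (v '' {e : Fin N | e ∈ B ∧ e < b}) →
    ¬ isExtActive v B j →
    insert j (B.erase b) ∈ 𝔅

end Lists

/-- The ideal `𝒥` generated by the cocircuit polynomials `p_C`. -/
def Jideal (X : Fin N → Fin r → ℝ) (G : Finset (Fin N)) (𝔅 : Set (Finset (Fin N))) :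
    Ideal (MvPolynomial (Fin r) ℝ) :=
  Ideal.span {p | ∃ C : Finset (Fin N), isCocircuitOn G 𝔅 C ∧ p = prodPoly X C}

/-- The generalised `𝒟`-space: the kernel of the cocircuit ideal. -/
def Dspace (X : Fin N → Fin r → ℝ) (G : Finset (Fin N)) (𝔅 : Set (Finset (Fin N))) :
    Submodule ℝ (MvPolynomial (Fin r) ℝ) :=
  kerIdeal (Jideal X G 𝔅)

/-- `Q_B := p_{X∖(B ∪ E(B))}` (within the ground set `G`). -/
def QB (X : Fin N → Fin r → ℝ) (G B : Finset (Fin N)) : MvPolynomial (Fin r) ℝ :=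
  prodPoly X (G \ (B ∪ extSetOn X G B))

/-- The central `𝒫`-space: the span of `p_Y` over sublists `Y` of `G` whose complement spans. -/
def PspaceOn (X : Fin N → Fin r → ℝ) (G : Finset (Fin N)) :
    Submodule ℝ (MvPolynomial (Fin r) ℝ) :=
  Submodule.span ℝ {p | ∃ Y : Finset (Fin N), Y ⊆ G ∧
    Submodule.span ℝ (X '' ((G \ Y : Finset (Fin N)) : Set (Fin N))) = ⊤ ∧ p = prodPoly X Y}

/-- The generalised `𝒫`-space `𝒫(X,𝔅') = span {Q_B : B ∈ 𝔅'}`. -/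
def PspaceB (X : Fin N → Fin r → ℝ) (G : Finset (Fin N)) (𝔅 : Set (Finset (Fin N))) :
    Submodule ℝ (MvPolynomial (Fin r) ℝ) :=
  Submodule.span ℝ {p | ∃ B ∈ 𝔅, p = QB X G B}

/-- The directional derivative `D_u = ∑ i, uᵢ ∂/∂tᵢ` as a linear map. -/
def dirDeriv {r : ℕ} (u : Fin r → ℝ) :
    MvPolynomial (Fin r) ℝ →ₗ[ℝ] MvPolynomial (Fin r) ℝ :=
  ∑ i, u i • (MvPolynomial.pderiv i).toLinearMap

end

/-- Placibility of a collection of (index sets of) bases, defined by recursion on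
cardinality: a singleton is placible; otherwise some `x` is placeable with both the
restriction and the deletion nonempty and placible. -/
inductive PlacibleF {N : ℕ} : Set (Finset (Fin N)) → Prop where
  | singleton (B : Finset (Fin N)) : PlacibleF {B}
  | step (𝔅 : Set (Finset (Fin N))) (x : Fin N)
      (hpl : ∀ B ∈ 𝔅, ∃ b ∈ B, insert x (B.erase b) ∈ 𝔅)
      (h1 : {B ∈ 𝔅 | x ∈ B}.Nonempty) (h2 : {B ∈ 𝔅 | x ∉ B}.Nonempty)
      (p1 : PlacibleF {B ∈ 𝔅 | x ∈ B}) (p2 : PlacibleF {B ∈ 𝔅 | x ∉ B}) :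
      PlacibleF 𝔅

open MvPolynomial in
theorem isHomogeneous_linPoly {r : ℕ} (u : Fin r → ℝ) : (linPoly u).IsHomogeneous 1 :=
  IsHomogeneous.sum _ _ _ fun _ _ => isHomogeneous_C_mul_X _ _

open MvPolynomial in
theorem isHomogeneous_prodPoly {r N : ℕ} (X : Fin N → Fin r → ℝ) (Y : Finset (Fin N)) :
    (prodPoly X Y).IsHomogeneous Y.card := by
  have h := IsHomogeneous.prod Y (fun i => linPoly (X i)) (fun _ => 1)
    fun i _ => isHomogeneous_linPoly (X i)
  simpa [prodPoly] using h

theorem eval_linPoly {r : ℕ} (u v : Fin r → ℝ) :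
    MvPolynomial.eval v (linPoly u) = u ⬝ᵥ v := by
  simp [linPoly, dotProduct]

theorem linPoly_single {r : ℕ} (i : Fin r) :
    linPoly (Pi.single i 1) = MvPolynomial.X i := by
  classical
  simp [linPoly, Pi.single_apply]

theorem linPoly_mem_of_span_eq_top {r : ℕ} {I : Ideal (MvPolynomial (Fin r) ℝ)}
    {s : Set (Fin r → ℝ)} (hs : Submodule.span ℝ s = ⊤) (hI : ∀ u ∈ s, linPoly u ∈ I)
    (u : Fin r → ℝ) : linPoly u ∈ I := by
  have hu : u ∈ Submodule.span ℝ s := hs ▸ Submodule.mem_top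
  induction hu using Submodule.span_induction with
  | mem u hu => exact hI u hu
  | zero => simp [linPoly]
  | add u v _ _ hu hv =>
    have : linPoly (u + v) = linPoly u + linPoly v := by
      simp [linPoly, add_mul, Finset.sum_add_distrib]
    exact this ▸ I.add_mem hu hv
  | smul c u _ hu =>
    have : linPoly (c • u) = MvPolynomial.C c * linPoly u := by
      simp [linPoly, mul_assoc, Finset.mul_sum]
    exact this ▸ I.mul_mem_left _ hu

theorem prodPoly_mem_Jideal {r N : ℕ} (X : Fin N → Fin r → ℝ) {𝔅 : Set (Finset (Fin N))}
    {C : Finset (Fin N)} (hC : ∀ B ∈ 𝔅, (C ∩ B).Nonempty) :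
    prodPoly X C ∈ Jideal X Finset.univ 𝔅 := by
  obtain ⟨C₀, hle, hmin⟩ := exists_minimal_le_of_wellFoundedLT
    (fun C : Finset (Fin N) => ∀ B ∈ 𝔅, (C ∩ B).Nonempty) C hC
  refine Ideal.mem_of_dvd _ (Finset.prod_dvd_prod_of_subset C₀ C _ hle) (Ideal.subset_span ?_)
  exact ⟨C₀, ⟨Finset.subset_univ _, hmin.prop, fun C' h h' => hmin.eq_of_le h' h⟩, rfl⟩

theorem Jideal_le_sup_of_placeable {r N : ℕ} (X : Fin N → Fin r → ℝ) {𝔅 : Set (Finset (Fin N))}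
    {x : Fin N} (hx : ∀ B ∈ 𝔅, ∃ b ∈ B, insert x (B.erase b) ∈ 𝔅) :
    Jideal X Finset.univ {B ∈ 𝔅 | x ∈ B} ≤
      Jideal X Finset.univ 𝔅 ⊔ Ideal.span {linPoly (X x)} := by
  refine Ideal.span_le.2 ?_
  rintro _ ⟨C, ⟨-, hC, -⟩, rfl⟩
  by_cases hxC : x ∈ C
  · exact Ideal.mem_sup_right (Ideal.mem_span_singleton.2 (Finset.dvd_prod_of_mem _ hxC))
  · refine Ideal.mem_sup_left (prodPoly_mem_Jideal X fun B hB => ?_)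
    obtain ⟨b, -, hb⟩ := hx B hB
    obtain ⟨c, hc⟩ := hC _ ⟨hb, Finset.mem_insert_self _ _⟩
    refine ⟨c, ?_⟩
    simp only [Finset.mem_inter, Finset.mem_insert, Finset.mem_erase] at hc ⊢
    grind

theorem linPoly_mul_mem_Jideal {r N : ℕ} (X : Fin N → Fin r → ℝ) {𝔅 : Set (Finset (Fin N))}
    {x : Fin N} {f : MvPolynomial (Fin r) ℝ} (hf : f ∈ Jideal X Finset.univ {B ∈ 𝔅 | x ∉ B}) :
    linPoly (X x) * f ∈ Jideal X Finset.univ 𝔅 := by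
  have hle : Jideal X Finset.univ {B ∈ 𝔅 | x ∉ B} ≤
      Submodule.comap (LinearMap.mulLeft (MvPolynomial (Fin r) ℝ) (linPoly (X x)))
        (Jideal X Finset.univ 𝔅) := by
    refine Ideal.span_le.2 ?_
    rintro _ ⟨C, ⟨-, hC, hmin⟩, rfl⟩
    have hxC : x ∉ C := by
      intro hxC
      have := hmin (C.erase x) (Finset.erase_subset _ _) fun B hB => by
        obtain ⟨c, hc⟩ := hC B hB
        refine ⟨c, ?_⟩
        have := hB.2
        simp only [Finset.mem_inter, Finset.mem_erase] at hc ⊢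
        grind
      exact Finset.erase_eq_self.1 this hxC
    have hprod : linPoly (X x) * prodPoly X C = prodPoly X (insert x C) :=
      (Finset.prod_insert hxC).symm
    rw [SetLike.mem_coe, Submodule.mem_comap, LinearMap.mulLeft_apply, hprod]
    refine prodPoly_mem_Jideal X fun B hB => ?_
    by_cases hxB : x ∈ B
    · exact ⟨x, by simp [hxB]⟩
    · obtain ⟨c, hc⟩ := hC B ⟨hB, hxB⟩
      exact ⟨c, by simp only [Finset.mem_inter, Finset.mem_insert] at hc ⊢; grind⟩
  exact hle hf

open MvPolynomial in
theorem PlacibleF.exists_spanning_finset {r N : ℕ} (X : Fin N → Fin r → ℝ)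
    {𝔅 : Set (Finset (Fin N))} (hp : PlacibleF 𝔅)
    (hspan : ∀ B ∈ 𝔅, Submodule.span ℝ (X '' (B : Set (Fin N))) = ⊤) :
    (∃ k, idealOfVars (Fin r) ℝ ^ k ≤ Jideal X Finset.univ 𝔅) ∧
      ∃ S : Finset (MvPolynomial (Fin r) ℝ), S.card ≤ 𝔅.ncard ∧
        ∀ f, ∃ s ∈ Submodule.span ℝ (S : Set (MvPolynomial (Fin r) ℝ)),
          f - s ∈ Jideal X Finset.univ 𝔅 := by
  classical
  induction hp with
  | singleton B =>
    have hlin := linPoly_mem_of_span_eq_top (I := Jideal X Finset.univ {B}) (hspan B rfl) <| by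
      rintro _ ⟨b, hb, rfl⟩
      have := prodPoly_mem_Jideal X (𝔅 := {B}) (C := {b}) fun B' hB' => by
        rw [Set.mem_singleton_iff.1 hB']
        exact ⟨b, by simpa using hb⟩
      simpa [prodPoly] using this
    have hle : idealOfVars (Fin r) ℝ ^ 1 ≤ Jideal X Finset.univ {B} := by
      rw [pow_one]
      refine Ideal.span_le.2 ?_
      rintro _ ⟨i, rfl⟩
      exact linPoly_single i ▸ hlin _
    refine ⟨⟨1, hle⟩, {1}, by simp, fun f => ⟨C (coeff 0 f), ?_, hle ?_⟩⟩
    · rw [C_eq_smul_one]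
      exact Submodule.smul_mem _ _ (Submodule.subset_span (by simp))
    · refine (mem_pow_idealOfVars_iff' _ _).2 fun α hα => ?_
      obtain rfl : α = 0 := (Finsupp.degree_eq_zero_iff α).1 (Nat.lt_one_iff.1 hα)
      simp
  | step 𝔅 x hpl _ _ _ _ ih₁ ih₂ =>
    obtain ⟨⟨k₁, hk₁⟩, S₁, hS₁, h₁⟩ := ih₁ fun B hB => hspan B hB.1
    obtain ⟨⟨k₂, hk₂⟩, S₂, hS₂, h₂⟩ := ih₂ fun B hB => hspan B hB.1
    have hsup := Jideal_le_sup_of_placeable X hpl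
    refine ⟨⟨k₁ + k₂, ?_⟩, S₁ ∪ S₂.image (linPoly (X x) * ·), ?_, fun f => ?_⟩
    · rw [pow_add, Ideal.mul_le]
      intro a ha b hb
      obtain ⟨j, hj, c, hc, rfl⟩ := Submodule.mem_sup.1 (hsup (hk₁ ha))
      obtain ⟨g, rfl⟩ := Ideal.mem_span_singleton.1 hc
      rw [add_mul, mul_right_comm]
      exact add_mem (Ideal.mul_mem_right _ _ hj)
        (Ideal.mul_mem_right _ _ (linPoly_mul_mem_Jideal X (hk₂ hb)))
    · have hcard : {B ∈ 𝔅 | x ∈ B}.ncard + {B ∈ 𝔅 | x ∉ B}.ncard = 𝔅.ncard :=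
        Set.ncard_inter_add_ncard_sdiff_eq_ncard 𝔅 {B | x ∈ B} (Set.toFinite _)
      have := Finset.card_union_le S₁ (S₂.image (linPoly (X x) * ·))
      have := Finset.card_image_le (s := S₂) (f := (linPoly (X x) * ·))
      omega
    · obtain ⟨s₁, hs₁, hf⟩ := h₁ f
      obtain ⟨j, hj, c, hc, hjc⟩ := Submodule.mem_sup.1 (hsup hf)
      obtain ⟨g, rfl⟩ := Ideal.mem_span_singleton.1 hc
      obtain ⟨s₂, hs₂, hg⟩ := h₂ g
      refine ⟨s₁ + linPoly (X x) * s₂, add_mem ?_ ?_, ?_⟩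
      · exact Submodule.span_mono (by simp) hs₁
      · have := Submodule.mem_map_of_mem (f := LinearMap.mulLeft ℝ (linPoly (X x))) hs₂
        rw [Submodule.map_span] at this
        refine Submodule.span_mono ?_ this
        intro y hy
        obtain ⟨z, hz, rfl⟩ := hy
        exact Finset.mem_union_right _ (Finset.mem_image_of_mem _ hz)
      · have : f - (s₁ + linPoly (X x) * s₂) = j + linPoly (X x) * (g - s₂) := by
          linear_combination -hjc
        rw [this]
        exact add_mem hj (linPoly_mul_mem_Jideal X hg)

open MvPolynomial in
/-- A functional on polynomials that annihilates the perturbed cocircuit products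
`∏ (p_c - λ_c)` and a set of monomials spanning modulo the cocircuit ideal vanishes. -/
theorem eq_zero_of_annihilates_perturbation {r N : ℕ} (X : Fin N → Fin r → ℝ)
    {𝔅 : Set (Finset (Fin N))} (c : Fin N → ℝ) (φ : MvPolynomial (Fin r) ℝ →ₗ[ℝ] ℝ)
    (hφ : ∀ Y : Finset (Fin N), (∀ B ∈ 𝔅, (Y ∩ B).Nonempty) → ∀ g,
      φ (g * ∏ i ∈ Y, (linPoly (X i) + C (-c i))) = 0)
    (S : Set (Fin r →₀ ℕ)) (hS : ∀ α ∈ S, φ (monomial α 1) = 0)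
    (hspan : ∀ f, ∃ s ∈ Submodule.span ℝ ((fun α => monomial α (1 : ℝ)) '' S),
      f - s ∈ Jideal X Finset.univ 𝔅) : φ = 0 := by
  classical
  have main : ∀ d, ∀ f : MvPolynomial (Fin r) ℝ, f.totalDegree < d → φ f = 0 := by
    intro d
    induction d with
    | zero => intro f hf; omega
    | succ d ih =>
      have hJ : ∀ j ∈ Jideal X Finset.univ 𝔅, φ (homogeneousComponent d j) = 0 := by
        intro j hj
        rw [Jideal, Ideal.span] at hj
        induction hj using Submodule.closure_induction with
        | zero => simp
        | add a b _ _ ha hb => simp [ha, hb]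
        | smul_mem g p hp =>
          obtain ⟨Y, ⟨-, hY, -⟩, rfl⟩ := hp
          rw [smul_eq_mul]
          induction g using MvPolynomial.induction_on' with
          | add g g' hg hg' => simp [add_mul, hg, hg']
          | monomial α a =>
            have hhom := (isHomogeneous_monomial a (rfl : α.degree = α.degree)).mul
              (isHomogeneous_prodPoly X Y)
            rw [homogeneousComponent_of_mem hhom]
            split_ifs with hd
            · have h := hφ Y hY (monomial α a)
              rw [Finset.prod_add, Finset.mul_sum, map_sum,
                Finset.sum_eq_single_of_mem Y (Finset.mem_powerset_self Y)] at h
              · simpa [prodPoly] using h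
              · intro T hT hTY
                apply ih
                have hlt := Finset.card_lt_card
                  ((Finset.mem_powerset.1 hT).ssubset_of_ne hTY)
                have h₁ := totalDegree_monomial_le α a
                have h₂ := (isHomogeneous_prodPoly X T).totalDegree_le
                rw [prodPoly] at h₂
                rw [← map_prod, ← mul_assoc]
                have h₃ := totalDegree_mul (monomial α a * ∏ i ∈ T, linPoly (X i))
                  (C (∏ i ∈ Y \ T, -c i))
                have h₄ := totalDegree_mul (monomial α a) (∏ i ∈ T, linPoly (X i))
                rw [totalDegree_C] at h₃
                have h₅ : (α.sum fun _ => id) = α.degree := rfl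
                omega
            · simp
      have hW : ∀ s ∈ Submodule.span ℝ ((fun α => monomial α (1 : ℝ)) '' S),
          φ (homogeneousComponent d s) = 0 := by
        intro s hs
        induction hs using Submodule.span_induction with
        | zero => simp
        | add a b _ _ ha hb => simp [ha, hb]
        | smul a b _ hb => simp [hb]
        | mem s hs =>
          obtain ⟨α, hα, rfl⟩ := hs
          rw [homogeneousComponent_of_mem (isHomogeneous_monomial (1 : ℝ) rfl)]
          split_ifs <;> simp [hS α hα]
      have hcomp : ∀ f, φ (homogeneousComponent d f) = 0 := by
        intro f
        obtain ⟨s, hs, hf⟩ := hspan f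
        rw [← sub_add_cancel f s, map_add, map_add, hJ _ hf, hW s hs, add_zero]
      intro f hf
      rw [← sum_homogeneousComponent f, map_sum]
      refine Finset.sum_eq_zero fun e he => ?_
      rw [Finset.mem_range] at he
      rcases (show e ≤ d by omega).lt_or_eq with h | rfl
      · exact ih _ ((homogeneousComponent_isHomogeneous e f).totalDegree_le.trans_lt h)
      · exact hcomp f
  exact LinearMap.ext fun f => main _ f (Nat.lt_succ_self _)

/-- For bases of `ℝ^r` taken from a list one can choose levels of the linear forms so that the
intersection points of the hyperplanes indexed by the bases are pairwise distinct. -/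
theorem exists_generic_vertices {r N : ℕ} (X : Fin N → Fin r → ℝ) {𝔅 : Set (Finset (Fin N))}
    (h𝔅 : 𝔅 ⊆ basesOn X Finset.univ) :
    ∃ (c : Fin N → ℝ) (v : Finset (Fin N) → Fin r → ℝ),
      (∀ B ∈ 𝔅, ∀ b ∈ B, X b ⬝ᵥ v B = c b) ∧ Set.InjOn v 𝔅 := by
  classical
  let U : Finset (Fin N) → Fin N → Submodule ℝ (Fin N → ℝ) := fun B x =>
    { carrier := {c | ∃ v : Fin r → ℝ, ∀ i ∈ insert x B, X i ⬝ᵥ v = c i}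
      add_mem' := by
        rintro a b ⟨v, hv⟩ ⟨w, hw⟩
        exact ⟨v + w, fun i hi => by simp [dotProduct_add, hv i hi, hw i hi]⟩
      zero_mem' := ⟨0, by simp⟩
      smul_mem' := by
        rintro a b ⟨v, hv⟩
        exact ⟨a • v, fun i hi => by simp [dotProduct_smul, hv i hi]⟩ }
  have hU : ∀ B ∈ 𝔅, ∀ x ∉ B, U B x ≠ ⊤ := by
    intro B hB x hx htop
    obtain ⟨v, hv⟩ : (Pi.single x 1 : Fin N → ℝ) ∈ U B x := htop ▸ Submodule.mem_top
    have hzero : ∀ u : Fin r → ℝ, u ⬝ᵥ v = 0 := by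
      intro u
      have hu : u ∈ Submodule.span ℝ (X '' (B : Set (Fin N))) := (h𝔅 hB).2.2 ▸ Submodule.mem_top
      induction hu using Submodule.span_induction with
      | zero => simp
      | add a b _ _ ha hb => simp [add_dotProduct, ha, hb]
      | smul a b _ hb => simp [smul_dotProduct, hb]
      | mem u hu =>
        obtain ⟨b, hb, rfl⟩ := hu
        rw [hv b (Finset.mem_insert_of_mem hb), Pi.single_eq_of_ne]
        rintro rfl
        exact hx hb
    have := hv x (Finset.mem_insert_self _ _)
    simp [hzero] at this
  obtain ⟨c, hc⟩ : ∃ c : Fin N → ℝ, ∀ B ∈ 𝔅, ∀ x ∉ B, c ∉ U B x := by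
    let s : Finset (Submodule ℝ (Fin N → ℝ)) :=
      ((Finset.univ : Finset (Finset (Fin N) × Fin N)).filter
        fun p => p.1 ∈ 𝔅 ∧ p.2 ∉ p.1).image fun p => U p.1 p.2
    have hs : ⊤ ∉ s := by
      intro h
      obtain ⟨p, hp, hpU⟩ := Finset.mem_image.1 h
      have hp := (Finset.mem_filter.1 hp).2
      exact hU p.1 hp.1 p.2 hp.2 hpU
    obtain ⟨c, hc⟩ := (Set.ne_univ_iff_exists_notMem _).1 (Subspace.biUnion_ne_univ_of_top_notMem hs)
    refine ⟨c, fun B hB x hx hcU => hc ?_⟩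
    refine Set.mem_biUnion (x := U B x) ?_ hcU
    exact Finset.mem_image.2 ⟨(B, x), by simp [hB, hx], rfl⟩
  have hv : ∀ B, ∃ v : Fin r → ℝ, B ∈ 𝔅 → ∀ b ∈ B, X b ⬝ᵥ v = c b := by
    intro B
    by_cases hB : B ∈ 𝔅
    · obtain ⟨-, hli, hsp⟩ := h𝔅 hB
      let e := Module.Basis.mk hli (hsp ▸ (congrArg _ (Set.range_domRestrict X _)).ge)
      let ψ : (Fin r → ℝ) →ₗ[ℝ] ℝ := e.constr ℝ fun b => c b
      refine ⟨fun i => ψ (Pi.single i 1), fun _ b hb => ?_⟩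
      have h₁ : ψ (X b) = c b := by
        have := e.constr_basis ℝ (fun b => c b) ⟨b, hb⟩
        rwa [Module.Basis.mk_apply] at this
      rw [← h₁, LinearMap.pi_apply_eq_sum_univ ψ (X b)]
      simp only [dotProduct, smul_eq_mul]
      refine Finset.sum_congr rfl fun i _ => ?_
      congr 2
      ext j
      simp [Pi.single_apply, eq_comm]
    · exact ⟨0, fun h => absurd h hB⟩
  choose v hv using hv
  refine ⟨c, v, hv, ?_⟩
  have key : ∀ B ∈ 𝔅, ∀ B' ∈ 𝔅, v B = v B' → B' ⊆ B := by
    intro B hB B' hB' heq x hx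
    by_contra hxB
    refine hc B hB x hxB ⟨v B, fun i hi => ?_⟩
    rcases Finset.mem_insert.1 hi with rfl | hi
    · rw [heq, hv B' hB' _ hx]
    · exact hv B hB i hi
  intro B hB B' hB' heq
  exact (key B' hB' B hB heq.symm).antisymm (key B hB B' hB' heq)

open MvPolynomial in
theorem ncard_le_of_monomials_span {r N : ℕ} (X : Fin N → Fin r → ℝ) {𝔅 : Set (Finset (Fin N))}
    (h𝔅 : 𝔅 ⊆ basesOn X Finset.univ) {S : Set (Fin r →₀ ℕ)} (hfin : S.Finite)
    (hspan : ∀ f, ∃ s ∈ Submodule.span ℝ ((fun α => monomial α (1 : ℝ)) '' S),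
      f - s ∈ Jideal X Finset.univ 𝔅) : 𝔅.ncard ≤ S.ncard := by
  classical
  obtain ⟨c, v, hv, hinj⟩ := exists_generic_vertices X h𝔅
  let ev : MvPolynomial (Fin r) ℝ →ₗ[ℝ] (𝔅 → ℝ) :=
    LinearMap.pi fun B => (aeval (R := ℝ) (v B)).toLinearMap
  have hev : ∀ f B, ev f B = eval (v B) f := fun f B => by simp [ev, aeval_eq_eval]
  let T : Set (𝔅 → ℝ) := (fun α => ev (monomial α 1)) '' S
  have hT : Submodule.span ℝ T = ⊤ := by
    by_contra hne
    obtain ⟨Φ, hΦ, hker⟩ := Submodule.exists_le_ker_of_lt_top _ (lt_top_iff_ne_top.2 hne)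
    have hzero : Φ ∘ₗ ev = 0 := by
      refine eq_zero_of_annihilates_perturbation X c _ ?_ S ?_ hspan
      · intro Y hY g
        have : ev (g * ∏ i ∈ Y, (linPoly (X i) + C (-c i))) = 0 := by
          funext B
          obtain ⟨b, hb⟩ := hY B B.2
          rw [Finset.mem_inter] at hb
          rw [hev, map_mul, map_prod, Finset.prod_eq_zero hb.1, mul_zero, Pi.zero_apply]
          simp [eval_linPoly, hv B B.2 b hb.2]
        rw [LinearMap.comp_apply, this, map_zero]
      · exact fun α hα => hker (Submodule.subset_span ⟨α, hα, rfl⟩)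
    let χ : 𝔅 → (MvPolynomial (Fin r) ℝ →* ℝ) := fun B => (eval (v B) : _ →+* ℝ)
    have hχ : Function.Injective χ := by
      intro B B' h
      refine Subtype.ext (hinj B.2 B'.2 (funext fun i => ?_))
      simpa [χ] using DFunLike.congr_fun h (MvPolynomial.X i)
    have hli := (linearIndependent_monoidHom (MvPolynomial (Fin r) ℝ) ℝ).comp χ hχ
    have hcoef := Fintype.linearIndependent_iff.1 hli (fun B => Φ (Pi.single B 1)) <| by
      funext f
      have h := LinearMap.congr_fun hzero f
      rw [LinearMap.comp_apply, LinearMap.pi_apply_eq_sum_univ Φ] at h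
      simp only [hev, LinearMap.zero_apply, smul_eq_mul] at h
      rw [Finset.sum_apply, Pi.zero_apply, ← h]
      refine Finset.sum_congr rfl fun B _ => ?_
      simp only [Pi.smul_apply, Function.comp_apply, smul_eq_mul, χ, MonoidHom.coe_coe]
      rw [mul_comm]
      congr 2
      ext j
      simp [Pi.single_apply, eq_comm]
    refine hΦ (LinearMap.pi_ext' fun B => LinearMap.ext_ring ?_)
    simpa using hcoef B
  have hTfin : T.Finite := hfin.image _
  have h₁ : Module.finrank ℝ (𝔅 → ℝ) ≤ T.ncard := by
    have := hTfin.fintype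
    rw [← finrank_top ℝ (𝔅 → ℝ), ← hT, Set.ncard_eq_toFinset_card']
    exact finrank_span_le_card T
  rw [Module.finrank_fintype_fun_eq_card, ← Nat.card_eq_fintype_card, Nat.card_coe_set_eq] at h₁
  exact h₁.trans (Set.ncard_image_le hfin)

theorem pairing_comm {r : ℕ} (p f : MvPolynomial (Fin r) ℝ) : pairing p f = pairing f p := by
  classical
  have key : ∀ p f : MvPolynomial (Fin r) ℝ, pairing p f = ∑ α ∈ p.support ∪ f.support,
      (∏ i, ((α i).factorial : ℝ)) * p.coeff α * f.coeff α := by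
    intro p f
    refine Finset.sum_subset Finset.subset_union_left fun α _ hα => ?_
    rw [MvPolynomial.notMem_support_iff.1 hα]
    ring
  rw [key p f, key f p, Finset.union_comm]
  exact Finset.sum_congr rfl fun _ _ => by ring

theorem pairing_monomial {r : ℕ} (α : Fin r →₀ ℕ) (f : MvPolynomial (Fin r) ℝ) :
    pairing (MvPolynomial.monomial α 1) f = (∏ i, ((α i).factorial : ℝ)) * f.coeff α := by
  classical
  simp [pairing, MvPolynomial.support_monomial]

/-- The pairing as a linear map from polynomials to functionals on polynomials. -/
noncomputable def pairingDual (r : ℕ) :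
    MvPolynomial (Fin r) ℝ →ₗ[ℝ] Module.Dual ℝ (MvPolynomial (Fin r) ℝ) :=
  LinearMap.mk₂ ℝ (fun f q => pairing q f)
    (fun f g q => pairing_add q f g) (fun c f q => pairing_smul q c f)
    (fun f p q => by simp only [pairing_comm _ f, pairing_add])
    (fun c f q => by simp only [pairing_comm _ f, pairing_smul, smul_eq_mul])

theorem pairingDual_injective (r : ℕ) : Function.Injective (pairingDual r) := by
  refine (injective_iff_map_eq_zero _).2 fun f hf => MvPolynomial.ext _ _ fun α => ?_
  have h : pairing (MvPolynomial.monomial α 1) f = 0 :=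
    LinearMap.congr_fun hf (MvPolynomial.monomial α 1)
  rw [pairing_monomial] at h
  refine (mul_eq_zero.1 h).resolve_left (Finset.prod_ne_zero_iff.2 fun i _ => ?_)
  exact_mod_cast (α i).factorial_ne_zero

open MvPolynomial in
theorem exists_pairingDual_eq {r k : ℕ} {φ : Module.Dual ℝ (MvPolynomial (Fin r) ℝ)}
    (hφ : ∀ q ∈ idealOfVars (Fin r) ℝ ^ k, φ q = 0) : ∃ f, pairingDual r f = φ := by
  classical
  have hzero : ∀ α : Fin r →₀ ℕ, k ≤ α.degree → φ (monomial α 1) = 0 := fun α hα =>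
    hφ _ ((monomial_mem_pow_idealOfVars_iff k α one_ne_zero).2 hα)
  let T : Finset (Fin r →₀ ℕ) := Finset.Iic (Finsupp.equivFunOnFinite.symm fun _ => k)
  have hT : ∀ α ∉ T, φ (monomial α 1) = 0 := by
    intro α hα
    apply hzero
    by_contra! hlt
    refine hα (Finset.mem_Iic.2 fun i => ?_)
    exact (Finsupp.le_degree i α).trans hlt.le
  refine ⟨∑ α ∈ T, monomial α (φ (monomial α 1) / ∏ i, ((α i).factorial : ℝ)), ?_⟩
  refine (basisMonomials (Fin r) ℝ).ext fun β => ?_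
  change pairing (monomial β 1) _ = φ (monomial β 1)
  have hβ : (∏ i, ((β i).factorial : ℝ)) ≠ 0 :=
    Finset.prod_ne_zero_iff.2 fun i _ => by exact_mod_cast (β i).factorial_ne_zero
  rw [pairing_monomial, coeff_sum]
  simp only [coeff_monomial, Finset.sum_ite_eq']
  split_ifs with h
  · field_simp
  · rw [mul_zero, hT β h]

open MvPolynomial in
theorem finrank_kerIdeal_eq {r k : ℕ} {I : Ideal (MvPolynomial (Fin r) ℝ)}
    (hI : idealOfVars (Fin r) ℝ ^ k ≤ I) :
    Module.finrank ℝ (kerIdeal I) =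
      Module.finrank ℝ (MvPolynomial (Fin r) ℝ ⧸ I.restrictScalars ℝ) := by
  let F : kerIdeal I →ₗ[ℝ] (I.restrictScalars ℝ).dualAnnihilator :=
    ((pairingDual r).domRestrict (kerIdeal I)).codRestrict _ fun f =>
      (Submodule.mem_dualAnnihilator _).2 f.2
  have hF : Function.Bijective F := by
    constructor
    · intro f g h
      exact Subtype.ext (pairingDual_injective r (congrArg Subtype.val h))
    · rintro ⟨φ, hφ⟩
      rw [Submodule.mem_dualAnnihilator] at hφ
      obtain ⟨f, rfl⟩ := exists_pairingDual_eq fun q hq => hφ q (hI hq)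
      exact ⟨⟨f, hφ⟩, rfl⟩
  rw [(LinearEquiv.ofBijective F hF).finrank_eq,
    ← (I.restrictScalars ℝ).dualQuotEquivDualAnnihilator.finrank_eq, Subspace.dual_finrank_eq]

/-- if `𝔅'` is placible then `dim 𝒟(X,𝔅') = |𝔅'|`. -/
theorem statement17 {r N : ℕ} (X : Fin N → Fin r → ℝ)
    (hX : Submodule.span ℝ (Set.range X) = ⊤)
    (𝔅' : Set (Finset (Fin N))) (hne : 𝔅'.Nonempty)
    (hsub : 𝔅' ⊆ basesOn X Finset.univ)
    (hp : PlacibleF 𝔅') :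
    Module.finrank ℝ ↥(Dspace X Finset.univ 𝔅') = 𝔅'.ncard := by
  classical
  obtain ⟨⟨k, hk⟩, S, hS, hspan⟩ := hp.exists_spanning_finset X fun B hB => (hsub hB).2.2
  rw [Dspace, finrank_kerIdeal_eq hk]
  set J := (Jideal X Finset.univ 𝔅').restrictScalars ℝ
  have htop : Submodule.span ℝ ((S.image J.mkQ : Finset _) : Set (_ ⧸ J)) = ⊤ := by
    rw [Finset.coe_image, ← Submodule.map_span, eq_top_iff]
    rintro q -
    obtain ⟨f, rfl⟩ := J.mkQ_surjective q
    obtain ⟨s, hs, hfs⟩ := hspan f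
    exact ⟨s, hs, ((Submodule.Quotient.eq J).2 hfs).symm⟩
  have : Module.Finite ℝ (_ ⧸ J) := ⟨⟨_, htop⟩⟩
  apply le_antisymm
  · rw [← finrank_top, ← htop]
    exact (finrank_span_finset_le_card _).trans (Finset.card_image_le.trans hS)
  · obtain ⟨κ, a, ha, hsp, hli⟩ := exists_linearIndependent' ℝ
      fun α : Fin r →₀ ℕ => J.mkQ (MvPolynomial.monomial α 1)
    have : Finite κ := hli.finite
    have : Fintype κ := Fintype.ofFinite κ
    have hle := ncard_le_of_monomials_span X hsub (Set.finite_range a) fun f => by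
      have hf : J.mkQ f ∈ Submodule.span ℝ
          (Set.range fun α : Fin r →₀ ℕ => J.mkQ (MvPolynomial.monomial α 1)) := by
        have := Submodule.mem_map_of_mem (f := J.mkQ)
          ((MvPolynomial.basisMonomials (Fin r) ℝ).mem_span f)
        rwa [Submodule.map_span, ← Set.range_comp] at this
      rw [← hsp, Set.range_comp, ← Function.comp_def J.mkQ, Set.image_comp,
        ← Submodule.map_span] at hf
      obtain ⟨s, hs, hfs⟩ := hf
      exact ⟨s, hs, (Submodule.Quotient.eq J).1 hfs.symm⟩
    refine hle.trans ?_
    rw [← Set.image_univ, Set.ncard_image_of_injective _ ha, Set.ncard_univ,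
      Nat.card_eq_fintype_card]
    exact hli.fintype_card_le_finrank
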